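/- arXiv:1711.11130 — 2 statements merged into one kernel-verified Lean document; each statement's English description precedes it below -/
import Mathlib

section
/- Let P ⊆ ℝ^m and Q ⊆ ℝ^n be full-dimensional convex polytopes (convex hulls of finite sets with nonempty interior) such that the origin of ℝ^m lies in P and the origin of ℝ^n lies in Q. Then the normalized volume of the free sum P ⊕ Q ⊆ ℝ^(m+n) is the product of the normalized volumes of P and Q; equivalently, (m+n)! · vol_{m+n}(P ⊕ Q) = (m! · vol_m(P)) · (n! · vol_n(Q)), where vol_k denotes k-dimensional Lebesgue measure. -/
open MeasureTheory

open Set Pointwise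

/-- The exponential distribution of rate one, as a measure on the real line. -/
noncomputable def unitExpMeasure : Measure ℝ :=
  (volume.restrict (Ioi 0)).withDensity fun t => ENNReal.ofReal (Real.exp (-t))

instance : SFinite unitExpMeasure := by
  unfold unitExpMeasure
  infer_instance

lemma unitExpMeasure_Ioi {a : ℝ} (ha : 0 ≤ a) :
    unitExpMeasure (Ioi a) = ENNReal.ofReal (Real.exp (-a)) := by
  rw [unitExpMeasure, withDensity_apply _ measurableSet_Ioi,
    Measure.restrict_restrict measurableSet_Ioi, inter_eq_left.2 (Ioi_subset_Ioi ha),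
    ← integral_exp_neg_Ioi a, ofReal_integral_eq_lintegral_ofReal (integrableOn_exp_neg_Ioi a)]
  exact Filter.Eventually.of_forall fun t => (Real.exp_pos _).le

lemma unitExpMeasure_Ici {a : ℝ} (ha : 0 ≤ a) :
    unitExpMeasure (Ici a) = ENNReal.ofReal (Real.exp (-a)) := by
  have h : Ioi a =ᵐ[unitExpMeasure] Ici a :=
    (withDensity_absolutelyContinuous _ _).ae_eq (ae_restrict_of_ae Ioi_ae_eq_Ici)
  rw [← measure_congr h, unitExpMeasure_Ioi ha]

lemma ae_unitExpMeasure_pos : ∀ᵐ t ∂unitExpMeasure, 0 < t :=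
  (withDensity_absolutelyContinuous _ _) (ae_restrict_mem measurableSet_Ioi)

lemma lintegral_pow_unitExpMeasure (k : ℕ) :
    ∫⁻ t, ENNReal.ofReal |t ^ k| ∂unitExpMeasure = (k.factorial : ENNReal) := by
  have hk : (0 : ℝ) < k + 1 := by positivity
  rw [unitExpMeasure, lintegral_withDensity_eq_lintegral_mul _ (by fun_prop) (by fun_prop),
    ← ENNReal.ofReal_natCast, ← Real.Gamma_nat_eq_factorial, Real.Gamma_eq_integral hk,
    ofReal_integral_eq_lintegral_ofReal (Real.GammaIntegral_convergent hk)]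
  · refine setLIntegral_congr_fun measurableSet_Ioi fun t (ht : 0 < t) => ?_
    simp only [Pi.mul_apply, add_sub_cancel_right, Real.rpow_natCast]
    rw [← ENNReal.ofReal_mul (Real.exp_pos _).le, abs_of_pos (pow_pos ht k)]
  · filter_upwards [ae_restrict_mem measurableSet_Ioi] with t (ht : 0 < t)
    simp only [Pi.zero_apply]
    positivity

/-- An upward closed set of nonnegative reals is, up to its infimum, a closed half-line. -/
lemma unitExpMeasure_of_isUpperSet {A : Set ℝ} (hA : A.Nonempty) (hpos : A ⊆ Ici 0)
    (hup : IsUpperSet A) : unitExpMeasure A = ENNReal.ofReal (Real.exp (-sInf A)) := by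
  have hinf : 0 ≤ sInf A := le_csInf hA fun _ h => hpos h
  apply le_antisymm
  · rw [← unitExpMeasure_Ici hinf]
    exact measure_mono fun t ht => csInf_le ⟨0, fun _ h => hpos h⟩ ht
  · rw [← unitExpMeasure_Ioi hinf]
    refine measure_mono fun t ht => ?_
    obtain ⟨s, hs, hst⟩ := exists_lt_of_csInf_lt hA ht
    exact hup hst.le hs

lemma unitExpMeasure_add {A B : Set ℝ} (hA : A ⊆ Ici 0) (hB : B ⊆ Ici 0)
    (hAup : IsUpperSet A) (hBup : IsUpperSet B) :
    unitExpMeasure (A + B) = unitExpMeasure A * unitExpMeasure B := by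
  rcases A.eq_empty_or_nonempty with rfl | hAne
  · simp
  rcases B.eq_empty_or_nonempty with rfl | hBne
  · simp
  have hAB : A + B ⊆ Ici 0 := by
    rintro _ ⟨a, ha, b, hb, rfl⟩
    exact add_nonneg (mem_Ici.1 (hA ha)) (mem_Ici.1 (hB hb))
  rw [unitExpMeasure_of_isUpperSet (hAne.add hBne) hAB hAup.add_right,
    unitExpMeasure_of_isUpperSet hAne hA hAup, unitExpMeasure_of_isUpperSet hBne hB hBup,
    csInf_add hAne ⟨0, fun _ h => hA h⟩ hBne ⟨0, fun _ h => hB h⟩,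
    ← ENNReal.ofReal_mul (Real.exp_pos _).le, ← Real.exp_add, neg_add]

/-- The nonnegative scalars `t` for which `x` belongs to the dilate `t • K`. -/
def dilationSet {E : Type*} [AddCommGroup E] [Module ℝ E] (K : Set E) (x : E) : Set ℝ :=
  {t | 0 ≤ t ∧ x ∈ t • K}

section FreeSum

variable {E F : Type*} [AddCommGroup E] [Module ℝ E] [AddCommGroup F] [Module ℝ F]

lemma dilationSet_subset_Ici (K : Set E) (x : E) : dilationSet K x ⊆ Ici 0 :=
  fun _ h => h.1

lemma isUpperSet_dilationSet {K : Set E} (hK : Convex ℝ K) (h0 : (0 : E) ∈ K) (x : E) :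
    IsUpperSet (dilationSet K x) := by
  rintro s t hst ⟨hs, y, hy, rfl⟩
  refine ⟨hs.trans hst, ?_⟩
  rcases (hs.trans hst).eq_or_lt with rfl | ht
  · obtain rfl : s = 0 := le_antisymm hst hs
    exact ⟨y, hy, rfl⟩
  · refine ⟨(s / t) • y, hK.smul_mem_of_zero_mem h0 hy
      ⟨by positivity, (div_le_one ht).2 hst⟩, ?_⟩
    simp only [smul_smul]
    rw [mul_div_cancel₀ _ ht.ne']

lemma unitExpMeasure_dilationSet (K : Set E) (x : E) :
    unitExpMeasure (dilationSet K x) = unitExpMeasure {t | t⁻¹ • x ∈ K} := by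
  refine measure_congr ?_
  filter_upwards [ae_unitExpMeasure_pos] with t ht
  exact propext ((and_iff_right ht.le).trans (mem_smul_set_iff_inv_smul_mem₀ ht.ne' K x))

/-- The free sum of two sets, each meant to contain the origin. -/
def freeSum (P : Set E) (Q : Set F) : Set (E × F) :=
  convexHull ℝ ((P ×ˢ ({0} : Set F)) ∪ (({0} : Set E) ×ˢ Q))

lemma mem_freeSum {P : Set E} {Q : Set F} (hP : Convex ℝ P) (hQ : Convex ℝ Q)
    (hPne : P.Nonempty) (hQne : Q.Nonempty) {z : E × F} :
    z ∈ freeSum P Q ↔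
      ∃ p ∈ P, ∃ q ∈ Q, ∃ a b : ℝ, 0 ≤ a ∧ 0 ≤ b ∧ a + b = 1 ∧ (a • p, b • q) = z := by
  rw [freeSum, convexHull_union (hPne.prod (singleton_nonempty _))
      ((singleton_nonempty _).prod hQne),
    (hP.prod (convex_singleton 0)).convexHull_eq, ((convex_singleton 0).prod hQ).convexHull_eq,
    mem_convexJoin]
  constructor
  · rintro ⟨⟨p, p'⟩, ⟨hp, rfl⟩, ⟨q', q⟩, ⟨rfl, hq⟩, a, b, ha, hb, hab, rfl⟩
    exact ⟨p, hp, q, hq, a, b, ha, hb, hab, by simp⟩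
  · rintro ⟨p, hp, q, hq, a, b, ha, hb, hab, rfl⟩
    exact ⟨(p, 0), ⟨hp, rfl⟩, (0, q), ⟨rfl, hq⟩, a, b, ha, hb, hab, by simp⟩

lemma dilationSet_freeSum {P : Set E} {Q : Set F} (hP : Convex ℝ P) (hQ : Convex ℝ Q)
    (hPne : P.Nonempty) (hQne : Q.Nonempty) (x : E) (y : F) :
    dilationSet (freeSum P Q) (x, y) = dilationSet P x + dilationSet Q y := by
  ext t
  constructor
  · rintro ⟨ht, z, hz, hzxy⟩
    obtain ⟨p, hp, q, hq, a, b, ha, hb, hab, rfl⟩ := (mem_freeSum hP hQ hPne hQne).1 hz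
    obtain ⟨rfl, rfl⟩ := Prod.ext_iff.1 hzxy
    refine ⟨t * a, ⟨by positivity, p, hp, mul_smul _ _ _⟩,
      t * b, ⟨by positivity, q, hq, mul_smul _ _ _⟩, ?_⟩
    simp only [← mul_add, hab, mul_one]
  · rintro ⟨a, ⟨ha, p, hp, rfl⟩, b, ⟨hb, q, hq, rfl⟩, rfl⟩
    refine ⟨add_nonneg ha hb, ?_⟩
    rcases (add_nonneg ha hb).eq_or_lt with h | h
    · obtain ⟨rfl, rfl⟩ := (add_eq_zero_iff_of_nonneg ha hb).1 h.symm
      exact ⟨((1 : ℝ) • p, (0 : ℝ) • q), (mem_freeSum hP hQ hPne hQne).2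
        ⟨p, hp, q, hq, 1, 0, by simp, by simp, by simp, rfl⟩, by simp [Prod.ext_iff]⟩
    · refine ⟨((a / (a + b)) • p, (b / (a + b)) • q), (mem_freeSum hP hQ hPne hQne).2
        ⟨p, hp, q, hq, _, _, by positivity, by positivity, by field_simp, rfl⟩, ?_⟩
      simp only [Prod.smul_mk, smul_smul, mul_div_cancel₀ _ h.ne']

lemma isCompact_freeSum [TopologicalSpace E] [ContinuousSMul ℝ E] [TopologicalSpace F]
    [ContinuousSMul ℝ F] {P : Set E} {Q : Set F} (hP : Convex ℝ P) (hQ : Convex ℝ Q)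
    (hPne : P.Nonempty) (hQne : Q.Nonempty) (hPc : IsCompact P) (hQc : IsCompact Q) :
    IsCompact (freeSum P Q) := by
  have hcont : Continuous fun w : ℝ × E × F => ((1 - w.1) • w.2.1, w.1 • w.2.2) := by fun_prop
  convert (isCompact_Icc.prod (hPc.prod hQc)).image hcont (s := Icc (0 : ℝ) 1 ×ˢ P ×ˢ Q)
  ext z
  rw [mem_freeSum hP hQ hPne hQne]
  constructor
  · rintro ⟨p, hp, q, hq, a, b, ha, hb, hab, rfl⟩
    obtain rfl : a = 1 - b := by linarith
    exact ⟨(b, p, q), ⟨⟨hb, by linarith⟩, hp, hq⟩, rfl⟩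
  · rintro ⟨⟨b, p, q⟩, ⟨⟨hb, hb'⟩, hp, hq⟩, rfl⟩
    exact ⟨p, hp, q, hq, 1 - b, b, by linarith, hb, by ring, rfl⟩

end FreeSum

section Volume

variable {E F : Type*} [NormedAddCommGroup E] [NormedSpace ℝ E] [FiniteDimensional ℝ E]
  [MeasurableSpace E] [BorelSpace E] [NormedAddCommGroup F] [NormedSpace ℝ F]
  [FiniteDimensional ℝ F] [MeasurableSpace F] [BorelSpace F]

lemma measurableSet_inv_smul_mem {K : Set E} (hK : MeasurableSet K) :
    MeasurableSet {w : E × ℝ | w.2⁻¹ • w.1 ∈ K} :=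
  (measurable_snd.inv.smul measurable_fst) hK

lemma measurable_unitExpMeasure_dilationSet {K : Set E} (hK : MeasurableSet K) :
    Measurable fun x => unitExpMeasure (dilationSet K x) := by
  simp only [unitExpMeasure_dilationSet]
  exact measurable_measure_prodMk_left (measurableSet_inv_smul_mem hK)

/-- Integrating the exponential weight of the dilation sets recovers the normalized volume. -/
lemma lintegral_unitExpMeasure_dilationSet (μ : Measure E) [μ.IsAddHaarMeasure] {K : Set E}
    (hK : MeasurableSet K) :
    ∫⁻ x, unitExpMeasure (dilationSet K x) ∂μ =
      ((Module.finrank ℝ E).factorial : ENNReal) * μ K := by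
  have hmeas := measurableSet_inv_smul_mem hK
  calc ∫⁻ x, unitExpMeasure (dilationSet K x) ∂μ
      = ∫⁻ x, unitExpMeasure {t | t⁻¹ • x ∈ K} ∂μ := by
        simp only [unitExpMeasure_dilationSet]
    _ = ∫⁻ t, μ {x | t⁻¹ • x ∈ K} ∂unitExpMeasure :=
        (Measure.prod_apply hmeas).symm.trans (Measure.prod_apply_symm hmeas)
    _ = ∫⁻ t, ENNReal.ofReal |t ^ Module.finrank ℝ E| * μ K ∂unitExpMeasure := by
        refine lintegral_congr_ae ?_
        filter_upwards [ae_unitExpMeasure_pos] with t ht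
        have h := Measure.addHaar_preimage_smul μ (inv_ne_zero ht.ne') K
        rwa [inv_pow, inv_inv] at h
    _ = _ := by
        rw [lintegral_mul_const _ (by fun_prop), lintegral_pow_unitExpMeasure]

/-- The product formula for the normalized volume of a free sum of compact convex sets. -/
theorem factorial_mul_addHaar_freeSum (μ : Measure E) [μ.IsAddHaarMeasure] (ν : Measure F)
    [ν.IsAddHaarMeasure] {P : Set E} {Q : Set F} (hP : Convex ℝ P) (hQ : Convex ℝ Q)
    (hPc : IsCompact P) (hQc : IsCompact Q) (hP0 : (0 : E) ∈ P) (hQ0 : (0 : F) ∈ Q) :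
    ((Module.finrank ℝ E + Module.finrank ℝ F).factorial : ENNReal) * μ.prod ν (freeSum P Q) =
      ((Module.finrank ℝ E).factorial * μ P) * ((Module.finrank ℝ F).factorial * ν Q) := by
  have hR : MeasurableSet (freeSum P Q) :=
    (isCompact_freeSum hP hQ ⟨0, hP0⟩ ⟨0, hQ0⟩ hPc hQc).measurableSet
  rw [← Module.finrank_prod, ← lintegral_unitExpMeasure_dilationSet (μ.prod ν) hR,
    ← lintegral_unitExpMeasure_dilationSet μ hPc.measurableSet,
    ← lintegral_unitExpMeasure_dilationSet ν hQc.measurableSet,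
    ← lintegral_prod_mul (measurable_unitExpMeasure_dilationSet hPc.measurableSet).aemeasurable
      (measurable_unitExpMeasure_dilationSet hQc.measurableSet).aemeasurable]
  refine lintegral_congr fun ⟨x, y⟩ => ?_
  rw [dilationSet_freeSum hP hQ ⟨0, hP0⟩ ⟨0, hQ0⟩,
    unitExpMeasure_add (dilationSet_subset_Ici P x) (dilationSet_subset_Ici Q y)
      (isUpperSet_dilationSet hP hP0 x) (isUpperSet_dilationSet hQ hQ0 y)]

end Volume

/-- **Product formula for the normalized volume of a free sum.**
If `P ⊆ ℝ^m` and `Q ⊆ ℝ^n` are full-dimensional convex polytopes (convex hulls of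
finite sets with nonempty interior), each containing the origin of its ambient space,
then `(m+n)! · vol(P ⊕ Q) = (m! · vol(P)) · (n! · vol(Q))`, where
`P ⊕ Q = conv((P × {0}) ∪ ({0} × Q)) ⊆ ℝ^m × ℝ^n ≅ ℝ^(m+n)`. -/
theorem free_sum_normalized_volume_product
    (m n : ℕ) (S : Finset (Fin m → ℝ)) (T : Finset (Fin n → ℝ))
    (P : Set (Fin m → ℝ)) (Q : Set (Fin n → ℝ))
    (hP : P = convexHull ℝ (S : Set (Fin m → ℝ)))
    (hQ : Q = convexHull ℝ (T : Set (Fin n → ℝ)))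
    (hPfull : (interior P).Nonempty) (hQfull : (interior Q).Nonempty)
    (hP0 : (0 : Fin m → ℝ) ∈ P) (hQ0 : (0 : Fin n → ℝ) ∈ Q) :
    (Nat.factorial (m + n) : ℝ) *
        (volume (convexHull ℝ
          ((P ×ˢ ({0} : Set (Fin n → ℝ))) ∪ (({0} : Set (Fin m → ℝ)) ×ˢ Q)))).toReal
      = ((Nat.factorial m : ℝ) * (volume P).toReal) *
        ((Nat.factorial n : ℝ) * (volume Q).toReal) := by
  have hPc : IsCompact P := hP ▸ S.finite_toSet.isCompact_convexHull ℝ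
  have hQc : IsCompact Q := hQ ▸ T.finite_toSet.isCompact_convexHull ℝ
  have hPconv : Convex ℝ P := hP ▸ convex_convexHull ℝ _
  have hQconv : Convex ℝ Q := hQ ▸ convex_convexHull ℝ _
  have h := congrArg ENNReal.toReal (factorial_mul_addHaar_freeSum
    (volume : Measure (Fin m → ℝ)) (volume : Measure (Fin n → ℝ)) hPconv hQconv hPc hQc hP0 hQ0)
  simp only [ENNReal.toReal_mul, ENNReal.toReal_natCast, Module.finrank_fin_fun] at h
  exact h
end

section
/- Let P ⊆ ℝ^m and Q ⊆ ℝ^n be full-dimensional lattice polytopes, i.e., P is the convex hull of a finite subset of ℤ^m with nonempty interior and Q is the convex hull of a finite subset of ℤ^n with nonempty interior, such that the origin of ℝ^m lies in P and the origin of ℝ^n lies in Q. Then (m+n)! · vol_{m+n}(P ⊕ Q) = (m! · vol_m(P)) · (n! · vol_n(Q)), where vol_k denotes k-dimensional Lebesgue measure. -/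
open MeasureTheory

open scoped Pointwise

namespace FreeSum

/-- Beta integral with natural-number exponents. -/
theorem factorial_mul_integral_one_sub_pow_mul_pow (m k : ℕ) :
    ((m + k + 1).factorial : ℝ) * ∫ t in (0 : ℝ)..1, (1 - t) ^ m * t ^ k
      = m.factorial * k.factorial := by
  induction m generalizing k with
  | zero =>
    simp only [pow_zero, one_mul, integral_pow, zero_add, Nat.factorial_succ]
    push_cast
    field_simp
    simp
  | succ m ih =>
    have hu : ∀ x ∈ Set.uIcc (0 : ℝ) 1,
        HasDerivAt (fun t : ℝ => (1 - t) ^ (m + 1)) (-((m + 1 : ℝ) * (1 - x) ^ m)) x := by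
      intro x _
      refine (((hasDerivAt_id' x).const_sub 1).fun_pow (m + 1)).congr_deriv ?_
      simp
    have hv : ∀ x ∈ Set.uIcc (0 : ℝ) 1,
        HasDerivAt (fun t : ℝ => t ^ (k + 1) / (k + 1)) (x ^ k) x := by
      intro x _
      refine ((hasDerivAt_pow (k + 1) x).div_const ((k : ℝ) + 1)).congr_deriv ?_
      push_cast
      field_simp
    have key := intervalIntegral.integral_mul_deriv_eq_deriv_mul hu hv
      (Continuous.intervalIntegrable (by fun_prop) _ _)
      (Continuous.intervalIntegrable (by fun_prop) _ _)
    have hint : ∫ x in (0 : ℝ)..1, -((m + 1 : ℝ) * (1 - x) ^ m) * (x ^ (k + 1) / (k + 1))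
        = -((m + 1) / (k + 1)) * ∫ x in (0 : ℝ)..1, (1 - x) ^ m * x ^ (k + 1) := by
      rw [← intervalIntegral.integral_const_mul]
      congr 1 with x
      field_simp
    rw [key, hint]
    have h := ih (k + 1)
    rw [show m + (k + 1) + 1 = m + 1 + k + 1 by ring] at h
    have hk : ((k + 1).factorial : ℝ) = (k + 1) * k.factorial := by
      rw [Nat.factorial_succ]; push_cast; ring
    have hm : ((m + 1).factorial : ℝ) = (m + 1) * m.factorial := by
      rw [Nat.factorial_succ]; push_cast; ring
    rw [hk] at h
    rw [hm]
    simp only [sub_self, sub_zero, ne_eq, Nat.add_eq_zero_iff, one_ne_zero, and_false,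
      not_false_eq_true, zero_pow, zero_mul, zero_div, mul_zero, zero_sub, neg_mul, neg_neg]
    rw [mul_left_comm, h]
    field_simp

section StarDepth

variable {E : Type*} [NormedAddCommGroup E] [NormedSpace ℝ E]

/-- The largest `s ∈ [0, 1]` with `x ∈ (1 - s) • K`, and `0` if `x ∉ K`. For `x ∈ K` it is
`1 - p x` with `p` the gauge of `K`. -/
noncomputable def starDepth (K : Set E) (x : E) : ℝ :=
  sSup {s : ℝ | s ∈ Set.Icc (0 : ℝ) 1 ∧ x ∈ (1 - s) • K}

variable {K : Set E}

theorem smul_subset_smul_of_le (hK : Convex ℝ K) (h0 : (0 : E) ∈ K) {a b : ℝ} (ha : 0 ≤ a)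
    (hab : a ≤ b) : a • K ⊆ b • K := by
  rintro _ ⟨z, hz, rfl⟩
  rcases (ha.trans hab).eq_or_lt with hb | hb
  · obtain rfl : a = b := le_antisymm hab (hb ▸ ha)
    exact ⟨z, hz, rfl⟩
  · refine ⟨(a / b) • z, hK.smul_mem_of_zero_mem h0 hz ⟨by positivity, ?_⟩, ?_⟩
    · exact (div_le_one hb).2 hab
    · simp only [smul_smul]
      rw [mul_div_cancel₀ _ hb.ne']

theorem starDepth_nonneg (K : Set E) (x : E) : 0 ≤ starDepth K x :=
  Real.sSup_nonneg fun _ hs => hs.1.1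

theorem starDepth_le_one (K : Set E) (x : E) : starDepth K x ≤ 1 :=
  Real.sSup_le (fun _ hs => hs.1.2) zero_le_one

theorem le_starDepth {s : ℝ} {x : E} (hs : s ∈ Set.Icc (0 : ℝ) 1) (hx : x ∈ (1 - s) • K) :
    s ≤ starDepth K x :=
  le_csSup ⟨1, fun _ h => h.1.2⟩ ⟨hs, hx⟩

theorem mem_one_sub_starDepth_smul (hK : IsCompact K) {x : E} (hx : x ∈ K) :
    x ∈ (1 - starDepth K x) • K := by
  have hcpt : IsCompact {s : ℝ | s ∈ Set.Icc (0 : ℝ) 1 ∧ x ∈ (1 - s) • K} := by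
    have hclosed : IsClosed {p : ℝ × E | (1 - p.1) • p.2 = x} :=
      isClosed_eq (by fun_prop) (by fun_prop)
    convert (((isCompact_Icc (a := (0 : ℝ)) (b := 1)).prod hK).inter_right hclosed).image
      continuous_fst using 1
    ext s
    constructor
    · rintro ⟨hs, z, hz, hzx⟩
      exact ⟨(s, z), ⟨⟨hs, hz⟩, hzx⟩, rfl⟩
    · rintro ⟨⟨s, z⟩, ⟨⟨hs, hz⟩, hzx⟩, rfl⟩
      exact ⟨hs, z, hz, hzx⟩
  exact (hcpt.sSup_mem ⟨0, by simp, by simpa using hx⟩).2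

theorem le_starDepth_iff (hK : IsCompact K) (hconv : Convex ℝ K) (h0 : (0 : E) ∈ K) {x : E}
    {s : ℝ} (hs : s ∈ Set.Ioc (0 : ℝ) 1) : s ≤ starDepth K x ↔ x ∈ (1 - s) • K := by
  refine ⟨fun h => ?_, le_starDepth (Set.Ioc_subset_Icc_self hs)⟩
  by_cases hx : x ∈ K
  · exact smul_subset_smul_of_le hconv h0 (sub_nonneg.2 (starDepth_le_one K x))
      (sub_le_sub_left h 1) (mem_one_sub_starDepth_smul hK hx)
  · have hzero : starDepth K x ≤ 0 := by
      refine Real.sSup_le (fun r hr => (hx ?_).elim) le_rfl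
      simpa using smul_subset_smul_of_le hconv h0 (sub_nonneg.2 hr.1.2)
        (sub_le_self 1 hr.1.1) hr.2
    exact absurd (h.trans hzero) (not_le.2 hs.1)

variable [MeasurableSpace E] [BorelSpace E]

theorem measurable_starDepth (hK : IsCompact K) (hconv : Convex ℝ K) (h0 : (0 : E) ∈ K) :
    Measurable (starDepth K) := by
  refine measurable_of_Ici fun s => ?_
  rcases le_or_gt s 0 with hs | hs
  · convert MeasurableSet.univ
    exact Set.eq_univ_of_forall fun x => hs.trans (starDepth_nonneg K x)
  rcases le_or_gt s 1 with hs' | hs'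
  · convert (hK.smul (1 - s)).measurableSet
    ext x
    exact le_starDepth_iff hK hconv h0 ⟨hs, hs'⟩
  · convert MeasurableSet.empty
    exact Set.eq_empty_of_forall_notMem fun x hx =>
      (hs'.trans_le hx).not_ge (starDepth_le_one K x)

variable [FiniteDimensional ℝ E] (μ : Measure E) [μ.IsAddHaarMeasure]

theorem lintegral_starDepth_pow (hK : IsCompact K) (hconv : Convex ℝ K) (h0 : (0 : E) ∈ K)
    (n : ℕ) :
    ∫⁻ x in K, ENNReal.ofReal (starDepth K x ^ n) ∂μ
      = ENNReal.ofReal ((Module.finrank ℝ E).factorial * n.factorial /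
          (Module.finrank ℝ E + n).factorial) * μ K := by
  set m := Module.finrank ℝ E with hm
  cases n with
  | zero => simp [Nat.factorial_ne_zero]
  | succ k =>
    have hlayer := lintegral_comp_eq_lintegral_meas_le_mul (f := starDepth K)
      (g := fun t => ((k : ℝ) + 1) * t ^ k) (μ.restrict K)
      (Filter.Eventually.of_forall (starDepth_nonneg K))
      (measurable_starDepth hK hconv h0).aemeasurable
      (fun t _ => Continuous.intervalIntegrable (by fun_prop) _ _)
      ((ae_restrict_iff' measurableSet_Ioi).2 <| Filter.Eventually.of_forall fun t ht => by
        have : (0 : ℝ) < t := ht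
        positivity)
    have hprim : ∀ x, ∫ t in (0 : ℝ)..starDepth K x, ((k : ℝ) + 1) * t ^ k
        = starDepth K x ^ (k + 1) := by
      intro x
      rw [intervalIntegral.integral_const_mul, integral_pow]
      field_simp
      simp
    simp only [hprim] at hlayer
    rw [hlayer]
    have hlevel : ∀ t ∈ Set.Ioi (0 : ℝ),
        μ.restrict K {a | t ≤ starDepth K a} * ENNReal.ofReal (((k : ℝ) + 1) * t ^ k)
          = (Set.Ioc (0 : ℝ) 1).indicator (fun t =>
              ENNReal.ofReal ((k + 1) * ((1 - t) ^ m * t ^ k)) * μ K) t := by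
      intro t ht
      have ht0 : (0 : ℝ) < t := ht
      by_cases ht1 : t ≤ 1
      · rw [Set.indicator_of_mem (Set.mem_Ioc.2 ⟨ht0, ht1⟩)]
        have hset : {a | t ≤ starDepth K a} = (1 - t) • K :=
          Set.ext fun a => le_starDepth_iff hK hconv h0 ⟨ht0, ht1⟩
        have hsub : (1 - t) • K ⊆ K := by
          simpa using smul_subset_smul_of_le hconv h0 (sub_nonneg.2 ht1) (sub_le_self 1 ht0.le)
        have hpow : 0 ≤ (1 - t) ^ m := pow_nonneg (sub_nonneg.2 ht1) _
        rw [hset, Measure.restrict_apply (hK.smul _).measurableSet,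
          Set.inter_eq_left.2 hsub, Measure.addHaar_smul, ← hm, abs_of_nonneg hpow,
          mul_right_comm, ← ENNReal.ofReal_mul hpow]
        congr 2
        ring
      · rw [Set.indicator_of_notMem fun h => ht1 h.2]
        have hset : {a | t ≤ starDepth K a} = ∅ :=
          Set.eq_empty_of_forall_notMem fun a ha => ht1 (ha.trans (starDepth_le_one K a))
        simp [hset]
    rw [setLIntegral_congr_fun measurableSet_Ioi hlevel, setLIntegral_indicator measurableSet_Ioc,
      Set.inter_eq_left.2 Set.Ioc_subset_Ioi_self, lintegral_mul_const _ (by fun_prop),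
      ← ofReal_integral_eq_lintegral_ofReal, ← intervalIntegral.integral_of_le zero_le_one,
      intervalIntegral.integral_const_mul]
    · congr 2
      rw [eq_div_iff (by positivity), Nat.factorial_succ k, ← add_assoc]
      have h := factorial_mul_integral_one_sub_pow_mul_pow m k
      push_cast
      linear_combination ((k : ℝ) + 1) * h
    · exact (intervalIntegrable_iff_integrableOn_Ioc_of_le zero_le_one).1
        (Continuous.intervalIntegrable (by fun_prop) _ _)
    · refine (ae_restrict_iff' measurableSet_Ioc).2 <| Filter.Eventually.of_forall fun t ht => ?_
      have h0t := ht.1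
      have h1t := sub_nonneg.2 ht.2
      simp only [Pi.zero_apply]
      positivity

end StarDepth

section Product

variable {E F : Type*} [NormedAddCommGroup E] [NormedSpace ℝ E] [NormedAddCommGroup F]
  [NormedSpace ℝ F] {P : Set E} {Q : Set F}

theorem convexHull_union_eq_image (hP : Convex ℝ P) (hQ : Convex ℝ Q) (hP0 : (0 : E) ∈ P)
    (hQ0 : (0 : F) ∈ Q) :
    convexHull ℝ ((P ×ˢ ({0} : Set F)) ∪ (({0} : Set E) ×ˢ Q))
      = (fun z : ℝ × E × F => ((1 - z.1) • z.2.1, z.1 • z.2.2)) ''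
          (Set.Icc (0 : ℝ) 1 ×ˢ P ×ˢ Q) := by
  rw [(hP.prod (convex_singleton 0)).convexHull_union ((convex_singleton 0).prod hQ)
    (Set.Nonempty.prod ⟨0, hP0⟩ (Set.singleton_nonempty 0))
    (Set.Nonempty.prod (Set.singleton_nonempty 0) ⟨0, hQ0⟩)]
  ext ⟨x, y⟩
  rw [mem_convexJoin]
  constructor
  · rintro ⟨⟨p, _⟩, ⟨hp, rfl⟩, ⟨_, q⟩, ⟨rfl, hq⟩, a, b, ha, hb, hab, h⟩
    refine ⟨(b, p, q), ⟨⟨hb, by linarith⟩, hp, hq⟩, ?_⟩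
    rw [← h, eq_sub_of_add_eq hab]
    simp
  · rintro ⟨⟨b, p, q⟩, ⟨⟨hb, hb'⟩, hp, hq⟩, h⟩
    refine ⟨(p, 0), ⟨hp, rfl⟩, (0, q), ⟨rfl, hq⟩, 1 - b, b, sub_nonneg.2 hb', hb, by ring, ?_⟩
    rw [← h]
    simp

theorem preimage_convexHull_union (hP : IsCompact P) (hPc : Convex ℝ P) (hQ : Convex ℝ Q)
    (hP0 : (0 : E) ∈ P) (hQ0 : (0 : F) ∈ Q) {x : E} (hx : x ∈ P) :
    Prod.mk x ⁻¹' convexHull ℝ ((P ×ˢ ({0} : Set F)) ∪ (({0} : Set E) ×ˢ Q))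
      = starDepth P x • Q := by
  rw [convexHull_union_eq_image hPc hQ hP0 hQ0]
  ext y
  constructor
  · rintro ⟨⟨b, p, q⟩, ⟨hb, hp, hq⟩, h⟩
    obtain ⟨h₁, h₂⟩ := Prod.ext_iff.1 h
    exact smul_subset_smul_of_le hQ hQ0 hb.1 (le_starDepth hb ⟨p, hp, h₁⟩) ⟨q, hq, h₂⟩
  · rintro ⟨q, hq, rfl⟩
    obtain ⟨p, hp, hpx⟩ := mem_one_sub_starDepth_smul hP hx
    exact ⟨(starDepth P x, p, q), ⟨⟨starDepth_nonneg P x, starDepth_le_one P x⟩, hp, hq⟩,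
      Prod.ext hpx rfl⟩

theorem preimage_convexHull_union_of_notMem (hPc : Convex ℝ P) (hQ : Convex ℝ Q)
    (hP0 : (0 : E) ∈ P) (hQ0 : (0 : F) ∈ Q) {x : E} (hx : x ∉ P) :
    Prod.mk x ⁻¹' convexHull ℝ ((P ×ˢ ({0} : Set F)) ∪ (({0} : Set E) ×ˢ Q)) = ∅ := by
  rw [convexHull_union_eq_image hPc hQ hP0 hQ0]
  refine Set.eq_empty_of_forall_notMem ?_
  rintro y ⟨⟨b, p, q⟩, ⟨hb, hp, hq⟩, h⟩
  refine hx ?_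
  have h₁ : (1 - b) • p = x := (Prod.ext_iff.1 h).1
  rw [← h₁]
  exact hPc.smul_mem_of_zero_mem hP0 hp ⟨sub_nonneg.2 hb.2, sub_le_self 1 hb.1⟩

variable [MeasurableSpace E] [BorelSpace E] [FiniteDimensional ℝ E]
  [MeasurableSpace F] [BorelSpace F] [FiniteDimensional ℝ F]
  (μ : Measure E) [μ.IsAddHaarMeasure] (ν : Measure F) [ν.IsAddHaarMeasure]

/-- The volume of the free sum of two compact convex sets containing the origin. -/
theorem prod_convexHull_union (hP : IsCompact P) (hPc : Convex ℝ P) (hP0 : (0 : E) ∈ P)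
    (hQ : IsCompact Q) (hQc : Convex ℝ Q) (hQ0 : (0 : F) ∈ Q) :
    μ.prod ν (convexHull ℝ ((P ×ˢ ({0} : Set F)) ∪ (({0} : Set E) ×ˢ Q)))
      = ENNReal.ofReal ((Module.finrank ℝ E).factorial * (Module.finrank ℝ F).factorial /
          (Module.finrank ℝ E + Module.finrank ℝ F).factorial) * μ P * ν Q := by
  have hmeas : MeasurableSet
      (convexHull ℝ ((P ×ˢ ({0} : Set F)) ∪ (({0} : Set E) ×ˢ Q))) := by
    rw [convexHull_union_eq_image hPc hQc hP0 hQ0]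
    exact ((isCompact_Icc.prod (hP.prod hQ)).image (by fun_prop)).measurableSet
  have hslice : ∀ x, ν (Prod.mk x ⁻¹'
      convexHull ℝ ((P ×ˢ ({0} : Set F)) ∪ (({0} : Set E) ×ˢ Q)))
        = P.indicator (fun x =>
            ENNReal.ofReal (starDepth P x ^ Module.finrank ℝ F) * ν Q) x := by
    intro x
    by_cases hx : x ∈ P
    · rw [preimage_convexHull_union hP hPc hQc hP0 hQ0 hx, Set.indicator_of_mem hx,
        Measure.addHaar_smul, abs_of_nonneg (pow_nonneg (starDepth_nonneg P x) _)]
    · rw [preimage_convexHull_union_of_notMem hPc hQc hP0 hQ0 hx, Set.indicator_of_notMem hx,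
        measure_empty]
  have hdepth := measurable_starDepth hP hPc hP0
  rw [Measure.prod_apply hmeas]
  simp only [hslice]
  rw [lintegral_indicator hP.measurableSet, lintegral_mul_const _ (by fun_prop),
    lintegral_starDepth_pow μ hP hPc hP0]

end Product

end FreeSum

/-- The product formula for the normalized volume of a free sum of two
full-dimensional *lattice* polytopes containing the origin. -/
theorem free_sum_normalized_volume_product_lattice
    (m n : ℕ) (S : Finset (Fin m → ℝ)) (T : Finset (Fin n → ℝ))
    (hS : ∀ v ∈ S, ∀ i, ∃ z : ℤ, v i = (z : ℝ))
    (hT : ∀ w ∈ T, ∀ j, ∃ z : ℤ, w j = (z : ℝ))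
    (P : Set (Fin m → ℝ)) (Q : Set (Fin n → ℝ))
    (hP : P = convexHull ℝ (S : Set (Fin m → ℝ)))
    (hQ : Q = convexHull ℝ (T : Set (Fin n → ℝ)))
    (hPfull : (interior P).Nonempty) (hQfull : (interior Q).Nonempty)
    (hP0 : (0 : Fin m → ℝ) ∈ P) (hQ0 : (0 : Fin n → ℝ) ∈ Q) :
    (Nat.factorial (m + n) : ℝ) *
        (volume (convexHull ℝ
          ((P ×ˢ ({0} : Set (Fin n → ℝ))) ∪ (({0} : Set (Fin m → ℝ)) ×ˢ Q)))).toReal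
      = ((Nat.factorial m : ℝ) * (volume P).toReal) *
        ((Nat.factorial n : ℝ) * (volume Q).toReal) := by
  subst hP hQ
  rw [Measure.volume_eq_prod, FreeSum.prod_convexHull_union volume volume
    (S.finite_toSet.isCompact_convexHull ℝ) (convex_convexHull ℝ _) hP0
    (T.finite_toSet.isCompact_convexHull ℝ) (convex_convexHull ℝ _) hQ0]
  simp only [Module.finrank_fin_fun, ENNReal.toReal_mul]
  rw [ENNReal.toReal_ofReal (by positivity)]
  field_simp
end
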